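/- Fix N ∈ ℕ and a smooth function M : (Fin N → ℝ) → (0, ∞). Let Ω ⊆ ℝ × ℝ × (Fin N → ℝ) be open (points written (U, V, o)) and let R : Ω → (0, ∞) be a smooth function satisfying the Kruskal relation (R/(2M(o)) − 1) · exp(R/(2M(o))) = −UV on Ω. Define A := (32 M(o)³ / R) · exp(−R/(2M(o))). Then the vacuum double-null equations hold on Ω: 4 R ∂_U∂_V R + 4 (∂_U R)(∂_V R) + A = 0, A ∂_U∂_U R − (∂_U A)(∂_U R) = 0, and A ∂_V∂_V R − (∂_V A)(∂_V R) = 0. -/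

import Mathlib

noncomputable section

/-- Points `(U, V, o)` with `o = (o¹, …, o^N)` the Dirac observables. -/
abbrev Pt (N : ℕ) := ℝ × ℝ × (Fin N → ℝ)

/-- The direction of the coordinate `U`. -/
def dU (N : ℕ) : Pt N := (1, 0, 0)

/-- The direction of the coordinate `V`. -/
def dV (N : ℕ) : Pt N := (0, 1, 0)

/-- Partial derivative of `f` in the direction `d` at `p`. -/
def pd {N : ℕ} (d : Pt N) (f : Pt N → ℝ) (p : Pt N) : ℝ := fderiv ℝ f p d

/-- The directional derivative is the derivative along the line in that direction. -/
theorem hasDerivAt_line {N : ℕ} {f : Pt N → ℝ} {p : Pt N} (hf : DifferentiableAt ℝ f p)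
    (d : Pt N) : HasDerivAt (fun t : ℝ => f (p + t • d)) (pd d f p) 0 :=
  hf.hasFDerivAt.hasLineDerivAt d

/-- Directions along which the observables are constant. -/
theorem observables_line {N : ℕ} {d : Pt N} (hd : d.2.2 = 0) (p : Pt N) (t : ℝ) :
    (p + t • d).2.2 = p.2.2 := by
  simp [hd]

theorem hasDerivAt_fst_line {N : ℕ} (d p : Pt N) :
    HasDerivAt (fun t : ℝ => (p + t • d).1) d.1 0 := by
  simpa using ((hasDerivAt_id (0 : ℝ)).mul_const d.1).const_add p.1

theorem hasDerivAt_snd_line {N : ℕ} (d p : Pt N) :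
    HasDerivAt (fun t : ℝ => (p + t • d).2.1) d.2.1 0 := by
  simpa using ((hasDerivAt_id (0 : ℝ)).mul_const d.2.1).const_add p.2.1

theorem eventually_line_mem {N : ℕ} {Ω : Set (Pt N)} (hΩ : IsOpen Ω) {p : Pt N} (hp : p ∈ Ω)
    (d : Pt N) : ∀ᶠ t : ℝ in nhds 0, p + t • d ∈ Ω := by
  have hc : Continuous fun t : ℝ => p + t • d := by fun_prop
  exact hc.continuousAt.eventually_mem (hΩ.mem_nhds (by simpa using hp))

/-- First derivatives of the Kruskal radius, by implicit differentiation. -/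
theorem pd_radius {N : ℕ} {M : (Fin N → ℝ) → ℝ} (hMpos : ∀ o, 0 < M o)
    {Ω : Set (Pt N)} (hΩ : IsOpen Ω) {R : Pt N → ℝ} (hRpos : ∀ p ∈ Ω, 0 < R p)
    (hrel : ∀ p ∈ Ω,
      (R p / (2 * M p.2.2) - 1) * Real.exp (R p / (2 * M p.2.2)) = -(p.1 * p.2.1))
    {A : Pt N → ℝ}
    (hAdef : ∀ p : Pt N,
      A p = 32 * M p.2.2 ^ 3 / R p * Real.exp (-(R p / (2 * M p.2.2))))
    {d : Pt N} (hd : d.2.2 = 0) {p : Pt N} (hp : p ∈ Ω) (hR : DifferentiableAt ℝ R p) :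
    pd d R p = -(A p * (d.1 * p.2.1 + p.1 * d.2.1)) / (8 * M p.2.2) := by
  have hm := hMpos p.2.2
  have hr := hRpos p hp
  have hx := (hasDerivAt_line hR d).div_const (2 * M p.2.2)
  have hl := (hx.sub_const 1).mul hx.exp
  have hw := ((hasDerivAt_fst_line d p).mul (hasDerivAt_snd_line d p)).neg
  have he := hl.unique (hw.congr_of_eventuallyEq (by
    filter_upwards [eventually_line_mem hΩ hp d] with t ht
    have := hrel _ ht
    rw [observables_line hd] at this
    exact this))
  simp only [zero_smul, add_zero] at he
  rw [hAdef, Real.exp_neg]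
  have hE := Real.exp_pos (R p / (2 * M p.2.2))
  generalize Real.exp (R p / (2 * M p.2.2)) = E at he hE ⊢
  field_simp at he ⊢
  linear_combination 8 * he

/-- Logarithmic derivative of the conformal factor `A` along a null coordinate. -/
theorem hasDerivAt_conformal_line {N : ℕ} {M : (Fin N → ℝ) → ℝ} (hMpos : ∀ o, 0 < M o)
    {R : Pt N → ℝ} {A : Pt N → ℝ}
    (hAdef : ∀ p : Pt N,
      A p = 32 * M p.2.2 ^ 3 / R p * Real.exp (-(R p / (2 * M p.2.2))))
    {d : Pt N} (hd : d.2.2 = 0) {p : Pt N} (hp : 0 < R p) (hR : DifferentiableAt ℝ R p) :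
    HasDerivAt (fun t : ℝ => A (p + t • d))
      (-(A p * pd d R p * (1 / R p + 1 / (2 * M p.2.2)))) 0 := by
  have hm := hMpos p.2.2
  have hl := hasDerivAt_line hR d
  have hA := ((hasDerivAt_const (0 : ℝ) (32 * M p.2.2 ^ 3)).div hl
    (by simpa using hp.ne')).mul (hl.div_const (2 * M p.2.2)).neg.exp
  refine (hA.congr_of_eventuallyEq (.of_forall fun t => ?_)).congr_deriv ?_
  · simp only [hAdef, observables_line hd]
    rfl
  · simp only [zero_smul, add_zero, hAdef, Pi.div_apply, Pi.neg_apply]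
    field_simp
    ring

/-- Second derivatives of the Kruskal radius in terms of first derivatives of `A`. -/
theorem pd_pd_radius {N : ℕ} {M : (Fin N → ℝ) → ℝ} (hMpos : ∀ o, 0 < M o)
    {Ω : Set (Pt N)} (hΩ : IsOpen Ω) {R : Pt N → ℝ} (hR : ContDiffOn ℝ (⊤ : ℕ∞) R Ω)
    (hRpos : ∀ p ∈ Ω, 0 < R p)
    (hrel : ∀ p ∈ Ω,
      (R p / (2 * M p.2.2) - 1) * Real.exp (R p / (2 * M p.2.2)) = -(p.1 * p.2.1))
    {A : Pt N → ℝ}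
    (hAdef : ∀ p : Pt N,
      A p = 32 * M p.2.2 ^ 3 / R p * Real.exp (-(R p / (2 * M p.2.2))))
    {d e : Pt N} (hd : d.2.2 = 0) (he : e.2.2 = 0) {p : Pt N} (hp : p ∈ Ω) :
    pd d (pd e R) p =
      -(-(A p * pd d R p * (1 / R p + 1 / (2 * M p.2.2))) * (e.1 * p.2.1 + p.1 * e.2.1)
        + A p * (e.1 * d.2.1 + d.1 * e.2.1)) / (8 * M p.2.2) := by
  have hRd : ∀ q ∈ Ω, DifferentiableAt ℝ R q := fun q hq =>
    (hR.contDiffAt (hΩ.mem_nhds hq)).differentiableAt (by simp)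
  have hdd : DifferentiableAt ℝ (pd e R) p := by
    have h : ContDiffAt ℝ 1 (fderiv ℝ R) p :=
      (hR.contDiffAt (hΩ.mem_nhds hp)).fderiv_right (by norm_cast)
    exact (h.differentiableAt (by simp)).clm_apply (differentiableAt_const e)
  have hA := hasDerivAt_conformal_line hMpos hAdef hd (hRpos p hp) (hRd p hp)
  have hw := ((hasDerivAt_snd_line d p).const_mul e.1).add
    ((hasDerivAt_fst_line d p).mul_const e.2.1)
  have hF := (hA.mul hw).neg.div_const (8 * M p.2.2)
  have h := (hasDerivAt_line hdd d).unique (hF.congr_of_eventuallyEq (by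
    filter_upwards [eventually_line_mem hΩ hp d] with t ht
    have := pd_radius hMpos hΩ hRpos hrel hAdef he ht (hRd _ ht)
    rw [observables_line hd] at this
    exact this))
  rw [h]
  simp

/- STATEMENT 12: The Schwarzschild radius function `R` of mass `M(o)` in
Kruskal coordinates, defined implicitly by `(R/(2M) − 1) e^{R/(2M)} = −UV`,
together with `A = (32 M³/R) e^{−R/(2M)}`, satisfies the vacuum double-null
Einstein equations on `Ω`. -/
theorem stmt_12 (N : ℕ)
    (M : (Fin N → ℝ) → ℝ) (hM : ContDiff ℝ (⊤ : ℕ∞) M) (hMpos : ∀ o, 0 < M o)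
    (Ω : Set (Pt N)) (hΩ : IsOpen Ω)
    (R : Pt N → ℝ) (hR : ContDiffOn ℝ (⊤ : ℕ∞) R Ω)
    (hRpos : ∀ p ∈ Ω, 0 < R p)
    (hrel : ∀ p ∈ Ω,
      (R p / (2 * M p.2.2) - 1) * Real.exp (R p / (2 * M p.2.2)) = -(p.1 * p.2.1))
    (A : Pt N → ℝ)
    (hAdef : ∀ p : Pt N,
      A p = 32 * M p.2.2 ^ 3 / R p * Real.exp (-(R p / (2 * M p.2.2)))) :
    ∀ p ∈ Ω,
      (4 * R p * pd (dU N) (pd (dV N) R) p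
        + 4 * pd (dU N) R p * pd (dV N) R p + A p = 0) ∧
      (A p * pd (dU N) (pd (dU N) R) p - pd (dU N) A p * pd (dU N) R p = 0) ∧
      (A p * pd (dV N) (pd (dV N) R) p - pd (dV N) A p * pd (dV N) R p = 0) := by
  intro p hp
  have hm := hMpos p.2.2
  have hr := hRpos p hp
  have hRd : DifferentiableAt ℝ R p :=
    (hR.contDiffAt (hΩ.mem_nhds hp)).differentiableAt (by simp)
  have hAd : DifferentiableAt ℝ A p := by
    have hMd : DifferentiableAt ℝ (fun q : Pt N => M q.2.2) p :=
      (hM.differentiable (by simp)).differentiableAt.comp p (by fun_prop)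
    rw [funext hAdef]
    have h2 : (2 * M p.2.2) ≠ 0 := by positivity
    simp only [div_eq_mul_inv]
    exact ((hMd.pow 3).const_mul 32 |>.mul (hRd.inv hr.ne')).mul
      (hRd.mul ((hMd.const_mul 2).inv h2)).neg.exp
  have hpdA : ∀ d : Pt N, d.2.2 = 0 →
      pd d A p = -(A p * pd d R p * (1 / R p + 1 / (2 * M p.2.2))) := fun d hd =>
    (hasDerivAt_line hAd d).unique (hasDerivAt_conformal_line hMpos hAdef hd hr hRd)
  have hU : (dU N).2.2 = 0 := rfl
  have hV : (dV N).2.2 = 0 := rfl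
  have hRU := pd_radius hMpos hΩ hRpos hrel hAdef hU hp hRd
  have hRV := pd_radius hMpos hΩ hRpos hrel hAdef hV hp hRd
  rw [pd_pd_radius hMpos hΩ hR hRpos hrel hAdef hU hV hp,
    pd_pd_radius hMpos hΩ hR hRpos hrel hAdef hU hU hp,
    pd_pd_radius hMpos hΩ hR hRpos hrel hAdef hV hV hp,
    hpdA _ hU, hpdA _ hV, hRU, hRV]
  simp only [dU, dV]
  refine ⟨?_, ?_, ?_⟩
  · have hk := hrel p hp
    have hA := hAdef p
    rw [Real.exp_neg] at hA
    have hE := Real.exp_pos (R p / (2 * M p.2.2))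
    generalize Real.exp (R p / (2 * M p.2.2)) = E at hk hA hE
    have hAE : E = 32 * M p.2.2 ^ 3 / (R p * A p) := by
      rw [hA]
      field_simp
    have hA0 : 0 < A p := by
      rw [hA]
      positivity
    rw [hAE] at hk
    clear hA hAE
    field_simp at hk ⊢
    linear_combination -2 * A p * hk
  · field_simp
    ring
  · field_simp
    ring
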